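/- Let ν_e be a Borel probability measure on ℝ₊ with ν_e({0})=0, finite mean, and finite second moment, with renewal function U_e(t) = ∑_{i≥0} F_e^{*i}(t). Then Lorden's inequality holds: U_e(t) ≤ t/⟨χ,ν_e⟩ + ⟨χ²,ν_e⟩/⟨χ,ν_e⟩² for all t ≥ 0. -/

import Mathlib

open MeasureTheory Set

/-- The `i`-fold convolution power of a measure on `ℝ` (with the 0th power the Dirac mass
at the origin). -/
noncomputable def iterConv (ν : Measure ℝ) : ℕ → Measure ℝ
  | 0 => Measure.dirac 0
  | n + 1 => ((iterConv ν n).prod ν).map (fun p : ℝ × ℝ => p.1 + p.2)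

lemma ic_prob (ν : Measure ℝ) [IsProbabilityMeasure ν] (n : ℕ) :
    IsProbabilityMeasure (iterConv ν n) := by
  induction n with
  | zero => unfold iterConv; infer_instance
  | succ n ih =>
    unfold iterConv
    exact Measure.isProbabilityMeasure_map (by fun_prop)

lemma ic_lint (ν : Measure ℝ) [IsProbabilityMeasure ν] (n : ℕ) (f : ℝ → ENNReal)
    (hf : Measurable f) :
    ∫⁻ s, f s ∂(iterConv ν (n+1)) = ∫⁻ s, ∫⁻ x, f (s + x) ∂ν ∂(iterConv ν n) := by
  have := ic_prob ν n
  rw [iterConv, lintegral_map hf (by fun_prop), lintegral_prod]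
  exact (hf.comp (by fun_prop)).aemeasurable

lemma ic_succ_apply (ν : Measure ℝ) [IsProbabilityMeasure ν] (n : ℕ) (c b : ℝ) :
    iterConv ν (n+1) (Ioc c (c+b)) = ∫⁻ x, iterConv ν n (Ioc (c - x) (c - x + b)) ∂ν := by
  have := ic_prob ν n
  rw [iterConv, Measure.map_apply (by fun_prop) measurableSet_Ioc,
    Measure.prod_apply_symm (measurableSet_Ioc.preimage (by fun_prop))]
  congr 1
  ext x
  congr 1
  ext s
  simp only [mem_preimage, mem_Ioc]
  constructor <;> rintro ⟨h1, h2⟩ <;> constructor <;> linarith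

lemma ic_nonneg (ν : Measure ℝ) [IsProbabilityMeasure ν] (hs : ∀ᵐ x ∂ν, 0 ≤ x) (n : ℕ) :
    ∀ᵐ s ∂(iterConv ν n), 0 ≤ s := by
  have hm : MeasurableSet {s : ℝ | 0 ≤ s} := measurableSet_Ici
  induction n with
  | zero =>
    unfold iterConv
    rw [ae_dirac_iff hm]
  | succ n ih =>
    have := ic_prob ν n
    rw [iterConv, ae_map_iff (by fun_prop) hm]
    have h1 := Measure.quasiMeasurePreserving_fst (μ := iterConv ν n) (ν := ν) |>.ae ih
    have h2 := Measure.quasiMeasurePreserving_snd (μ := iterConv ν n) (ν := ν) |>.ae hs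
    filter_upwards [h1, h2] with p h1 h2
    exact add_nonneg h1 h2

noncomputable def renU (ν : Measure ℝ) (t : ℝ) : ENNReal := ∑' i : ℕ, iterConv ν i (Iic t)

lemma renU_mono (ν : Measure ℝ) : Monotone (renU ν) := fun _ _ h =>
  ENNReal.tsum_le_tsum fun _ => measure_mono (Iic_subset_Iic.2 h)

lemma visits_le (ν : Measure ℝ) [IsProbabilityMeasure ν] (b : ℝ) (n : ℕ) : ∀ c : ℝ,
    ∑ i ∈ Finset.range n, iterConv ν i (Ioc c (c+b)) ≤ renU ν b := by
  induction n with
  | zero => intro c; simp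
  | succ n ih =>
    intro c
    rcases lt_or_ge c 0 with hc | hc
    · refine le_trans (Finset.sum_le_sum fun i _ => measure_mono (t := Iic b) ?_)
        (ENNReal.sum_le_tsum _)
      intro x hx
      exact hx.2.trans (by linarith)
    · rw [Finset.sum_range_succ']
      have h0 : iterConv ν 0 (Ioc c (c+b)) = 0 := by
        rw [iterConv, Measure.dirac_apply' _ measurableSet_Ioc]
        simp [hc.not_gt]
      rw [h0, add_zero]
      simp_rw [ic_succ_apply]
      have hmeas : ∀ i, Measurable fun x => iterConv ν i (Ioc (c - x) (c - x + b)) := by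
        intro i
        have := ic_prob ν i
        have hS : MeasurableSet {p : ℝ × ℝ | c - p.1 < p.2 ∧ p.2 ≤ c - p.1 + b} :=
          MeasurableSet.inter (s₁ := {p : ℝ × ℝ | c - p.1 < p.2})
            (s₂ := {p : ℝ × ℝ | p.2 ≤ c - p.1 + b})
            (measurableSet_lt (by fun_prop) (by fun_prop))
            (measurableSet_le (by fun_prop) (by fun_prop))
        exact measurable_measure_prodMk_left (ν := iterConv ν i) hS
      rw [← lintegral_finsetSum _ (fun i _ => hmeas i)]
      calc _ ≤ ∫⁻ _, renU ν b ∂ν := lintegral_mono fun x => ih (c - x)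
        _ = _ := by simp

lemma renU_subadd (ν : Measure ℝ) [IsProbabilityMeasure ν] (a b : ℝ) :
    renU ν (a + b) ≤ renU ν a + renU ν b := by
  have h : ∑' i, iterConv ν i (Ioc a (a+b)) ≤ renU ν b :=
    ENNReal.tsum_le_of_sum_range_le fun n => visits_le ν b n a
  refine le_trans ?_ (add_le_add le_rfl h)
  rw [renU, renU, ← ENNReal.tsum_add]
  refine ENNReal.tsum_le_tsum fun i => le_trans (measure_mono ?_) (measure_union_le _ _)
  intro x hx
  rcases le_or_gt x a with h | h
  · exact Or.inl h
  · exact Or.inr ⟨h, hx⟩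

noncomputable def Qm (ν : Measure ℝ) : Measure ℝ :=
  (volume.restrict (Ici 0)).withDensity fun y => ν (Ioi y)

lemma meas_tail (ν : Measure ℝ) : Measurable fun y : ℝ => ν (Ioi y) :=
  Antitone.measurable fun _ _ h => measure_mono (Ioi_subset_Ioi h)

lemma Q_lint (ν : Measure ℝ) [IsProbabilityMeasure ν] (f : ℝ → ENNReal) (hf : Measurable f) :
    ∫⁻ y, f y ∂(Qm ν) = ∫⁻ x, (∫⁻ y in Ico 0 x, f y) ∂ν := by
  rw [Qm, lintegral_withDensity_eq_lintegral_mul _ (meas_tail ν) hf]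
  have h1 : ∀ y, ((fun y => ν (Ioi y)) * f) y = ∫⁻ x, (Ioi y).indicator (fun _ => f y) x ∂ν := by
    intro y
    rw [lintegral_indicator measurableSet_Ioi]
    simp [mul_comm]
  simp_rw [h1]
  rw [lintegral_lintegral_swap]
  · congr 1
    ext x
    rw [← lintegral_indicator measurableSet_Ici, ← lintegral_indicator measurableSet_Ico]
    congr 1
    ext y
    simp only [indicator, mem_Ici, mem_Ioi, mem_Ico]
    by_cases h : 0 ≤ y <;> by_cases h' : y < x <;> simp [h, h']
  · have : Function.uncurry (fun (y x : ℝ) => (Ioi y).indicator (fun _ => f y) x)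
      = {p : ℝ × ℝ | p.1 < p.2}.indicator (fun p => f p.1) := by
      ext p; rfl
    rw [this]
    exact ((hf.comp measurable_fst).indicator
      (measurableSet_lt measurable_fst measurable_snd)).aemeasurable

lemma stat_le (ν : Measure ℝ) [IsProbabilityMeasure ν] (hs : ∀ᵐ x ∂ν, 0 ≤ x)
    [SFinite (Qm ν)] (t : ℝ) (ht : 0 ≤ t) :
    ∫⁻ y, renU ν (t - y) ∂(Qm ν) ≤ ENNReal.ofReal t := by
  have hmeas : ∀ i, Measurable fun y => iterConv ν i (Iic (t - y)) := fun i =>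
    Antitone.measurable fun _ _ h => measure_mono (Iic_subset_Iic.2 (by linarith))
  unfold renU
  rw [lintegral_tsum fun i => (hmeas i).aemeasurable]
  have hg : ∀ i, ∫⁻ y, iterConv ν i (Iic (t - y)) ∂(Qm ν)
      = ∫⁻ s, ∫⁻ x, ENNReal.ofReal (min x (t - s)) ∂ν ∂(iterConv ν i) := by
    intro i
    have := ic_prob ν i
    have h1 : ∀ y, iterConv ν i (Iic (t - y))
        = ∫⁻ s, {p : ℝ × ℝ | p.1 + p.2 ≤ t}.indicator (fun _ => 1) (y, s) ∂(iterConv ν i) := by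
      intro y
      rw [← lintegral_indicator_one measurableSet_Iic]
      congr 1
      ext s
      simp only [indicator, mem_Iic, mem_setOf_eq, le_sub_iff_add_le, add_comm, Pi.one_apply]
    have hS : MeasurableSet {p : ℝ × ℝ | p.1 + p.2 ≤ t} :=
      measurableSet_le (by fun_prop) (by fun_prop)
    have hI : Measurable ({p : ℝ × ℝ | p.1 + p.2 ≤ t}.indicator (fun _ => (1 : ENNReal))) :=
      measurable_const.indicator hS
    simp_rw [h1]
    rw [lintegral_lintegral_swap
      (f := fun y s => {p : ℝ × ℝ | p.1 + p.2 ≤ t}.indicator (fun _ => (1 : ENNReal)) (y, s))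
      hI.aemeasurable]
    congr 1
    ext s
    rw [Q_lint ν (fun y => {p : ℝ × ℝ | p.1 + p.2 ≤ t}.indicator (fun _ => (1 : ENNReal)) (y, s))
      (hI.comp (by fun_prop : Measurable fun y : ℝ => (y, s)))]
    congr 1
    ext x
    have h2 : ∀ y, {p : ℝ × ℝ | p.1 + p.2 ≤ t}.indicator (fun _ => (1 : ENNReal)) (y, s)
       = (Iic (t - s)).indicator 1 y := by
      intro y
      simp only [indicator, mem_Iic, mem_setOf_eq, le_sub_iff_add_le, Pi.one_apply]
    simp_rw [h2]
    rw [lintegral_indicator_one measurableSet_Iic, Measure.restrict_apply measurableSet_Iic]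
    rcases lt_or_ge (t - s) x with h | h
    · have : Iic (t - s) ∩ Ico 0 x = Icc 0 (t - s) := by
        ext y; simp only [mem_inter_iff, mem_Iic, mem_Ico, mem_Icc]
        constructor
        · rintro ⟨a, b, c⟩; exact ⟨b, a⟩
        · rintro ⟨a, b⟩; exact ⟨b, a, by linarith⟩
      rw [this, min_eq_right h.le]; simp
    · have : Iic (t - s) ∩ Ico 0 x = Ico 0 x := by
        ext y; simp only [mem_inter_iff, mem_Iic, mem_Ico]
        constructor
        · rintro ⟨a, b, c⟩; exact ⟨b, c⟩
        · rintro ⟨a, b⟩; exact ⟨by linarith, a, b⟩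
      rw [this, min_eq_left h]; simp
  simp_rw [hg]
  refine ENNReal.tsum_le_of_sum_range_le fun n => ?_
  have hsum : ∑ i ∈ Finset.range n,
      ∫⁻ s, ∫⁻ x, ENNReal.ofReal (min x (t - s)) ∂ν ∂(iterConv ν i)
      = ∫⁻ s, ENNReal.ofReal (min s t) ∂(iterConv ν n) := by
    induction n with
    | zero => simp [iterConv, lintegral_dirac, ht]
    | succ n ih =>
      rw [Finset.sum_range_succ, ih, ic_lint ν n _ (by fun_prop),
        ← lintegral_add_left (by fun_prop)]
      refine lintegral_congr_ae ?_
      filter_upwards [ic_nonneg ν hs n] with s hs0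
      have : ∫⁻ x, ENNReal.ofReal (min (s + x) t) ∂ν
          = ∫⁻ x, (ENNReal.ofReal (min s t) + ENNReal.ofReal (min x (t - s))) ∂ν := by
        refine lintegral_congr_ae ?_
        filter_upwards [hs] with x hx
        rcases le_or_gt s t with h | h
        · rw [← ENNReal.ofReal_add (le_min hs0 ht) (le_min hx (by linarith)), min_eq_left h,
            ← min_add_add_left]
          congr 2; ring
        · rw [min_eq_right h.le, min_eq_right (by linarith : t ≤ s + x),
            ENNReal.ofReal_of_nonpos ((min_le_right _ _).trans (by linarith)), add_zero]
      rw [this, lintegral_add_left (by fun_prop)]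
      simp
  rw [hsum]
  have := ic_prob ν n
  calc _ ≤ ∫⁻ _, ENNReal.ofReal t ∂(iterConv ν n) :=
        lintegral_mono fun s => ENNReal.ofReal_le_ofReal (min_le_right _ _)
    _ = _ := by simp

theorem stmt13 (ν : Measure ℝ) [IsProbabilityMeasure ν]
    (hsupp : ν (Iio 0) = 0) (h0 : ν {0} = 0)
    (hint1 : Integrable (fun x => x) ν) (hint2 : Integrable (fun x => x ^ 2) ν)
    (hm : 0 < ∫ x, x ∂ν) :
    ∀ t ≥ (0:ℝ), (∑' i : ℕ, iterConv ν i (Iic t)) ≤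
      ENNReal.ofReal (t / (∫ x, x ∂ν) + (∫ x, x ^ 2 ∂ν) / (∫ x, x ∂ν) ^ 2) := by
  intro t ht
  have hs : ∀ᵐ x ∂ν, 0 ≤ x := by
    rw [ae_iff]
    simpa [Iio, not_le] using hsupp
  set m := ∫ x, x ∂ν with hmdef
  set M := ∫ x, x ^ 2 ∂ν with hMdef
  have hM : 0 ≤ M := integral_nonneg fun x => sq_nonneg x
  have hmass : Qm ν univ = ENNReal.ofReal m := by
    rw [← lintegral_one, Q_lint ν _ (by fun_prop), hmdef,
      ofReal_integral_eq_lintegral_ofReal hint1 hs]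
    simp
  have hmean : ∫⁻ y, ENNReal.ofReal y ∂(Qm ν) = ENNReal.ofReal (M / 2) := by
    rw [Q_lint ν _ (by fun_prop), hMdef, ← integral_div,
      ofReal_integral_eq_lintegral_ofReal (hint2.div_const 2)
        (Filter.Eventually.of_forall fun x => by positivity)]
    refine lintegral_congr_ae ?_
    filter_upwards [hs] with x hx
    rw [← ofReal_integral_eq_lintegral_ofReal]
    · rw [integral_Ico_eq_integral_Ioc, ← intervalIntegral.integral_of_le hx]
      simp
    · exact (continuous_id.integrableOn_Icc (a := 0) (b := x)).mono_set Ico_subset_Icc_self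
    · filter_upwards [ae_restrict_mem measurableSet_Ico] with y hy using hy.1
  have : IsFiniteMeasure (Qm ν) := ⟨by rw [hmass]; exact ENNReal.ofReal_lt_top⟩
  have hQ : ∀ᵐ y ∂(Qm ν), 0 ≤ y :=
    (withDensity_absolutelyContinuous _ _).ae_le (ae_restrict_mem measurableSet_Ici)
  have hUm : Measurable (renU ν) := (renU_mono ν).measurable
  have key : renU ν t * ENNReal.ofReal m * ENNReal.ofReal m ≤ ENNReal.ofReal (t * m + M) := by
    calc renU ν t * ENNReal.ofReal m * ENNReal.ofReal m
        = ∫⁻ y, ∫⁻ z, renU ν t ∂(Qm ν) ∂(Qm ν) := by simp [hmass]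
      _ ≤ ∫⁻ y, ∫⁻ z, (renU ν (t + y - z) + renU ν (z - y)) ∂(Qm ν) ∂(Qm ν) := by
        refine lintegral_mono fun y => lintegral_mono fun z => ?_
        have := renU_subadd ν (t + y - z) (z - y)
        rwa [show t + y - z + (z - y) = t by ring] at this
      _ = ∫⁻ y, ∫⁻ z, renU ν (t + y - z) ∂(Qm ν) ∂(Qm ν)
          + ∫⁻ y, ∫⁻ z, renU ν (z - y) ∂(Qm ν) ∂(Qm ν) := by
        rw [← lintegral_add_right]
        · congr 1
          ext y
          rw [lintegral_add_right]
          exact hUm.comp (by fun_prop)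
        · exact Measurable.lintegral_prod_right'
            (f := fun p : ℝ × ℝ => renU ν (p.2 - p.1)) (hUm.comp (by fun_prop))
      _ ≤ ∫⁻ y, (ENNReal.ofReal t + ENNReal.ofReal y) ∂(Qm ν)
          + ∫⁻ z, ENNReal.ofReal z ∂(Qm ν) := by
        refine add_le_add (lintegral_mono_ae ?_) ?_
        · filter_upwards [hQ] with y hy
          rw [← ENNReal.ofReal_add ht hy]
          exact stat_le ν hs _ (add_nonneg ht hy)
        · rw [lintegral_lintegral_swap (f := fun y z => renU ν (z - y)) (hUm.comp (by fun_prop :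
            Measurable fun p : ℝ × ℝ => p.2 - p.1)).aemeasurable]
          refine lintegral_mono_ae ?_
          filter_upwards [hQ] with z hz
          exact stat_le ν hs _ hz
      _ = ENNReal.ofReal (t * m + M) := by
        rw [lintegral_add_left (by fun_prop), hmean, lintegral_const, hmass,
          ← ENNReal.ofReal_mul ht, ← ENNReal.ofReal_add (by positivity) (by positivity),
          ← ENNReal.ofReal_add (by positivity) (by positivity)]
        congr 1; ring
  change renU ν t ≤ _
  rw [mul_assoc, ← ENNReal.ofReal_mul hm.le] at key
  have : t / m + M / m ^ 2 = (t * m + M) / (m * m) := by field_simp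
  rw [this, ENNReal.ofReal_div_of_pos (by positivity)]
  rw [ENNReal.le_div_iff_mul_le (Or.inl (by simpa using hm.ne'))
    (Or.inl ENNReal.ofReal_ne_top)]
  exact key
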